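/- Let Γ(0,z) = ∫_z^∞ e^{−t}/t dt for z > 0 denote the incomplete gamma function. Then, as ε → 0⁺, ∑_{(k₁,k₂) ∈ ℤ², (k₁,k₂) ≠ (0,0)} Γ(0, ε·(k₁² + k₁k₂ + k₂²)) = (2π/√3)·(1/ε) − log(1/ε) + γ + log( 4π² / (√3·Γ(1/3)⁶) ) + o(1); equivalently, the difference between the sum and (2π/√3)/ε − log(1/ε) tends to γ + log(4π²/(√3·Γ(1/3)⁶)) as ε → 0⁺. -/

import Mathlib

open MeasureTheory Real Filter

/-- The incomplete gamma function `Γ(0, z) = ∫_z^∞ e^{-t}/t dt` for `z > 0`. -/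
noncomputable def incGamma (z : ℝ) : ℝ := ∫ t in Set.Ioi z, Real.exp (-t) / t

open Topology

/-- The number of zeros of `X² + X + 1` in `ZMod n`. -/
noncomputable def cubeRootCount : ArithmeticFunction ℤ where
  toFun n := Nat.card {b : ZMod n // b ^ 2 + b + 1 = 0}
  map_zero' := by
    have : IsEmpty {b : ZMod 0 // b ^ 2 + b + 1 = 0} := by
      refine ⟨fun ⟨b, hb⟩ => ?_⟩
      change ℤ at b
      have hb : b ^ 2 + b + 1 = (0 : ℤ) := hb
      have h0 : b * (b + 1) = -1 := by linear_combination hb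
      have h1 : 0 ≤ b * (b + 1) := by
        rcases le_or_gt 0 b with h | h
        · positivity
        · exact mul_nonneg_of_nonpos_of_nonpos h.le (by omega)
      omega
    simp

/-- The nontrivial Dirichlet character modulo `3`, as an arithmetic function. -/
def chiThree : ArithmeticFunction ℤ where
  toFun n := if n % 3 = 1 then 1 else if n % 3 = 2 then -1 else 0
  map_zero' := by simp

/-- The indicator function of the positive squares. -/
noncomputable def squareIndicator : ArithmeticFunction ℤ where
  toFun n := open Classical in if n ≠ 0 ∧ IsSquare n then 1 else 0
  map_zero' := by simp

lemma cubeRootCount_apply (n : ℕ) :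
    cubeRootCount n = Nat.card {b : ZMod n // b ^ 2 + b + 1 = 0} := rfl

lemma chiThree_apply (n : ℕ) :
    chiThree n = if n % 3 = 1 then 1 else if n % 3 = 2 then -1 else 0 := rfl

lemma chiThree_mul (m n : ℕ) : chiThree (m * n) = chiThree m * chiThree n := by
  have hm : m % 3 < 3 := Nat.mod_lt _ (by norm_num)
  have hn : n % 3 < 3 := Nat.mod_lt _ (by norm_num)
  simp only [chiThree_apply, Nat.mul_mod m n]
  interval_cases m % 3 <;> interval_cases n % 3 <;> simp

lemma chiThree_one : chiThree 1 = 1 := by simp [chiThree_apply]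

lemma isMultiplicative_chiThree : chiThree.IsMultiplicative :=
  ⟨chiThree_one, fun _ => chiThree_mul _ _⟩

lemma chiThree_pow (m k : ℕ) : chiThree (m ^ k) = chiThree m ^ k := by
  induction k with
  | zero => simp [chiThree_one]
  | succ k ih => rw [pow_succ, chiThree_mul, ih, pow_succ]

lemma isMultiplicative_squareIndicator : squareIndicator.IsMultiplicative := by
  refine ⟨by simp [squareIndicator], fun {m n} h => ?_⟩
  simp only [squareIndicator, ArithmeticFunction.coe_mk]
  rcases eq_or_ne m 0 with rfl | hm
  · simp
  rcases eq_or_ne n 0 with rfl | hn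
  · simp
  have : IsSquare (m * n) ↔ IsSquare m ∧ IsSquare n := by
    constructor
    · rintro ⟨r, hr⟩
      have key : ∀ {a b : ℕ}, a.Coprime b → a * b = r ^ 2 → IsSquare a := fun hab he => by
        obtain ⟨d, rfl⟩ := exists_eq_pow_of_mul_eq_pow (Nat.isUnit_iff.2 hab) he
        exact ⟨d, sq d⟩
      exact ⟨key h (by rw [hr, sq]), key h.symm (by rw [mul_comm, hr, sq])⟩
    · rintro ⟨h1, h2⟩
      exact h1.mul h2
  by_cases h1 : IsSquare m <;> by_cases h2 : IsSquare n <;> simp [this, hm, hn, h1, h2]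

lemma isMultiplicative_cubeRootCount : cubeRootCount.IsMultiplicative := by
  refine ⟨?_, fun {m n} h => ?_⟩
  · rw [cubeRootCount_apply]
    have : Unique {b : ZMod 1 // b ^ 2 + b + 1 = 0} :=
      ⟨⟨⟨0, Subsingleton.elim _ _⟩⟩, fun _ => Subsingleton.elim _ _⟩
    rw [Nat.card_unique, Nat.cast_one]
  · simp only [cubeRootCount_apply]
    rw [← Nat.cast_mul, ← Nat.card_prod]
    congr 1
    refine Nat.card_congr (Equiv.trans (Equiv.subtypeEquiv (q := fun b : ZMod m × ZMod n =>
      b.1 ^ 2 + b.1 + 1 = 0 ∧ b.2 ^ 2 + b.2 + 1 = 0) (ZMod.chineseRemainder h).toEquiv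
      fun b => ?_) (Equiv.subtypeProdEquivProd (p := fun b : ZMod m => b ^ 2 + b + 1 = 0)
        (q := fun b : ZMod n => b ^ 2 + b + 1 = 0)))
    rw [← (ZMod.chineseRemainder h).injective.eq_iff]
    simp [Prod.ext_iff]

lemma three_dvd_sub_one_of_root {p : ℕ} [Fact p.Prime] (hp : p ≠ 3) {b : ZMod p}
    (hb : b ^ 2 + b + 1 = 0) : p % 3 = 1 := by
  have h3 : b ^ 3 = 1 := by linear_combination (b - 1) * hb
  have h1 : b ≠ 1 := by
    rintro rfl
    have : ((3 : ℕ) : ZMod p) = 0 := by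
      push_cast; linear_combination hb
    rw [ZMod.natCast_eq_zero_iff] at this
    exact hp ((Nat.prime_dvd_prime_iff_eq Fact.out Nat.prime_three).1 this)
  have ho : orderOf b = 3 := orderOf_eq_prime h3 h1
  have hb0 : b ≠ 0 := by rintro rfl; simp at hb
  have := ZMod.orderOf_dvd_card_sub_one hb0
  rw [ho] at this
  have := (Fact.out : p.Prime).two_le
  omega

lemma cubeRootCount_prime_pow_of_mod_one {p : ℕ} (hp : p.Prime) (h : p % 3 = 1) {k : ℕ}
    (hk : k ≠ 0) : cubeRootCount (p ^ k) = 2 := by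
  have : Fact p.Prime := ⟨hp⟩
  have : NeZero (p ^ k) := ⟨pow_ne_zero _ hp.ne_zero⟩
  have hlt : 1 < p ^ k := Nat.one_lt_pow hk hp.one_lt
  have : Fact (1 < p ^ k) := ⟨hlt⟩
  have hunit : ∀ a : ℤ, IsUnit (a : ZMod (p ^ k)) ↔ ¬ (p : ℤ) ∣ a := by
    intro a
    rw [ZMod.coe_int_isUnit_iff_isCoprime, Nat.cast_pow, IsCoprime.pow_left_iff (by omega),
      (Nat.prime_iff_prime_int.1 hp).irreducible.coprime_iff_not_dvd]
  -- an element of order three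
  have hcard : 3 ∣ Fintype.card (ZMod (p ^ k))ˣ := by
    rw [ZMod.card_units_eq_totient, Nat.totient_prime_pow hp (by omega)]
    exact Dvd.dvd.mul_left (by have := hp.two_le; omega) _
  obtain ⟨u, hu⟩ := exists_prime_orderOf_dvd_card 3 hcard
  have hu3 : (u : ZMod (p ^ k)) ^ 3 = 1 := by
    rw [← Units.val_pow_eq_pow_val, ← hu, pow_orderOf_eq_one, Units.val_one]
  obtain ⟨z, hz⟩ := ZMod.intCast_surjective (u : ZMod (p ^ k))
  have hz1 : ¬ (p : ℤ) ∣ z - 1 := by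
    intro hd
    have h1 : (p : ℤ) ^ (1 + (k - 1)) ∣ z ^ p ^ (k - 1) - 1 ^ p ^ (k - 1) := by
      have := dvd_sub_pow_of_dvd_sub (R := ℤ) (p := p) (a := z) (b := 1) hd (k - 1)
      rwa [add_comm]
    have h2 : u ^ p ^ (k - 1) = 1 := by
      ext
      rw [Units.val_pow_eq_pow_val, ← hz, Units.val_one, ← sub_eq_zero]
      rw [one_pow, show 1 + (k - 1) = k by omega] at h1
      have := (ZMod.intCast_zmod_eq_zero_iff_dvd (z ^ p ^ (k - 1) - 1) (p ^ k)).2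
        (by exact_mod_cast h1)
      exact_mod_cast this
    have h3 := orderOf_dvd_of_pow_eq_one h2
    rw [hu] at h3
    have := (Nat.prime_dvd_prime_iff_eq Nat.prime_three hp).1 (Nat.prime_three.dvd_of_dvd_pow h3)
    omega
  have hroot : (z : ZMod (p ^ k)) ^ 2 + z + 1 = 0 := by
    have hun : IsUnit ((z - 1 : ℤ) : ZMod (p ^ k)) := (hunit _).2 hz1
    refine hun.mul_left_cancel ?_
    push_cast
    rw [← hz] at hu3
    linear_combination hu3
  have hdisc : ¬ (p : ℤ) ∣ 2 * z + 1 := by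
    intro hd
    have h1 : ((z ^ 2 + z + 1 : ℤ) : ZMod (p ^ k)) = 0 := by push_cast; exact hroot
    rw [ZMod.intCast_zmod_eq_zero_iff_dvd] at h1
    have h2 : (p : ℤ) ∣ z ^ 2 + z + 1 :=
      (dvd_pow_self (p : ℤ) hk).trans (by exact_mod_cast h1)
    have h3 : (p : ℤ) ∣ 3 := by
      have := (h2.mul_left 4).sub (hd.mul_right (2 * z + 1))
      ring_nf at this
      exact this
    have h4 : p ∣ 3 := by exact_mod_cast h3
    have := (Nat.prime_dvd_prime_iff_eq hp Nat.prime_three).1 h4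
    omega
  rw [cubeRootCount_apply]
  have hroot' : (-1 - z : ZMod (p ^ k)) ^ 2 + (-1 - z) + 1 = 0 := by linear_combination hroot
  suffices Nat.card {b : ZMod (p ^ k) // b ^ 2 + b + 1 = 0} = 2 by rw [this]; rfl
  rw [Nat.card_eq_two_iff]
  refine ⟨⟨z, hroot⟩, ⟨-1 - z, hroot'⟩, ?_, ?_⟩
  · intro he
    have he : (z : ZMod (p ^ k)) = -1 - z := congrArg Subtype.val he
    have h1 : ((2 * z + 1 : ℤ) : ZMod (p ^ k)) = 0 := by push_cast; linear_combination he
    have := (hunit _).2 hdisc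
    rw [h1] at this
    exact not_isUnit_zero this
  · ext ⟨b, hb⟩
    simp only [Set.mem_insert_iff, Set.mem_singleton_iff, Subtype.mk.injEq, Set.mem_univ, iff_true]
    obtain ⟨w, rfl⟩ := ZMod.intCast_surjective b
    have hprod : ((w - z : ℤ) : ZMod (p ^ k)) * ((w + 1 + z : ℤ) : ZMod (p ^ k)) = 0 := by
      push_cast; linear_combination hb - hroot
    by_cases hd : (p : ℤ) ∣ w - z
    · left
      have hn : ¬ (p : ℤ) ∣ w + 1 + z := fun h' => hdisc (by
        have := h'.sub hd
        ring_nf at this ⊢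
        exact this)
      have := ((hunit _).2 hn).mul_left_eq_zero.1 hprod
      push_cast at this
      exact sub_eq_zero.1 this
    · right
      have := ((hunit _).2 hd).mul_right_eq_zero.1 hprod
      push_cast at this
      linear_combination this

lemma cubeRootCount_prime_pow_of_mod_two {p : ℕ} (hp : p.Prime) (h : p % 3 = 2) {k : ℕ}
    (hk : k ≠ 0) : cubeRootCount (p ^ k) = 0 := by
  have : Fact p.Prime := ⟨hp⟩
  rw [cubeRootCount_apply]
  have : IsEmpty {b : ZMod (p ^ k) // b ^ 2 + b + 1 = 0} := by
    refine ⟨fun ⟨b, hb⟩ => ?_⟩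
    have := three_dvd_sub_one_of_root (p := p) (by omega)
      (b := ZMod.castHom (dvd_pow_self p hk) (ZMod p) b)
      (by rw [← map_pow, ← map_add, ← map_one (ZMod.castHom (dvd_pow_self p hk) (ZMod p)),
            ← map_add, hb, map_zero])
    omega
  simp

lemma cubeRootCount_three : cubeRootCount 3 = 1 := by
  rw [cubeRootCount_apply, Nat.card_eq_fintype_card]
  rfl

lemma cubeRootCount_three_pow {k : ℕ} (hk : 2 ≤ k) : cubeRootCount (3 ^ k) = 0 := by
  rw [cubeRootCount_apply]
  have : IsEmpty {b : ZMod (3 ^ k) // b ^ 2 + b + 1 = 0} := by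
    refine ⟨fun ⟨b, hb⟩ => ?_⟩
    have hd : 9 ∣ 3 ^ k := pow_dvd_pow 3 hk
    have h9 : ∀ c : ZMod 9, c ^ 2 + c + 1 ≠ 0 := by decide
    refine h9 (ZMod.castHom hd (ZMod 9) b) ?_
    rw [← map_pow, ← map_add, ← map_one (ZMod.castHom hd (ZMod 9)), ← map_add, hb, map_zero]
  simp

lemma cubeRootCount_prime_pow_succ {p : ℕ} (hp : p.Prime) (k : ℕ) :
    cubeRootCount (p ^ (k + 1)) = chiThree p ^ (k + 1) + chiThree p ^ k := by
  have h3 : p % 3 < 3 := Nat.mod_lt _ (by norm_num)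
  have hcases : p % 3 = 0 ∨ p % 3 = 1 ∨ p % 3 = 2 := by omega
  rcases hcases with h | h | h
  · obtain rfl : 3 = p :=
      (Nat.prime_dvd_prime_iff_eq Nat.prime_three hp).1 (Nat.dvd_of_mod_eq_zero h)
    rcases k with _ | k
    · simp [cubeRootCount_three, chiThree_apply]
    · rw [cubeRootCount_three_pow (by omega)]
      simp [chiThree_apply]
  · rw [cubeRootCount_prime_pow_of_mod_one hp h (by omega)]
    simp [chiThree_apply, h]
  · rw [cubeRootCount_prime_pow_of_mod_two hp h (by omega)]
    simp [chiThree_apply, h, pow_succ]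

lemma squareIndicator_prime_pow {p : ℕ} (hp : p.Prime) (k : ℕ) :
    squareIndicator (p ^ k) = if Even k then 1 else 0 := by
  have : IsSquare (p ^ k) ↔ Even k := by
    constructor
    · rintro ⟨r, hr⟩
      have hr0 : r ≠ 0 := by
        rintro rfl
        exact pow_ne_zero k hp.ne_zero hr
      have := congrArg (fun m => m.factorization p) hr
      simp only [Nat.factorization_mul hr0 hr0, Finsupp.add_apply, hp.factorization_pow,
        Finsupp.single_eq_same] at this
      exact ⟨_, this⟩
    · exact fun h => h.isSquare_pow p
  simp [squareIndicator, this, hp.ne_zero]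

lemma squareIndicator_mul_cubeRootCount :
    squareIndicator * cubeRootCount = chiThree * (ArithmeticFunction.zeta : ArithmeticFunction ℤ) := by
  refine (ArithmeticFunction.IsMultiplicative.eq_iff_eq_on_prime_powers _
    (isMultiplicative_squareIndicator.mul isMultiplicative_cubeRootCount) _
    (isMultiplicative_chiThree.mul ArithmeticFunction.isMultiplicative_zeta.natCast)).2
    fun p k hp => ?_
  have hr : ∀ k, (chiThree * (ArithmeticFunction.zeta : ArithmeticFunction ℤ)) (p ^ k)
      = ∑ i ∈ Finset.range (k + 1), chiThree p ^ i := by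
    intro k
    rw [ArithmeticFunction.coe_mul_zeta_apply, Nat.sum_divisors_prime_pow hp]
    simp [chiThree_pow]
  have hl : ∀ k, (squareIndicator * cubeRootCount) (p ^ k)
      = ∑ i ∈ Finset.range (k + 1), (if Even i then 1 else 0) * cubeRootCount (p ^ (k - i)) := by
    intro k
    rw [ArithmeticFunction.mul_apply, Nat.sum_divisorsAntidiagonal
      (f := fun a b => squareIndicator a * cubeRootCount b), Nat.sum_divisors_prime_pow hp]
    refine Finset.sum_congr rfl fun i hi => ?_
    rw [squareIndicator_prime_pow hp, Nat.pow_div (by simp at hi; omega) hp.pos]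
  have h1 : cubeRootCount 1 = 1 := isMultiplicative_cubeRootCount.1
  rw [hl, hr]
  induction k using Nat.twoStepInduction with
  | zero =>
    rw [Finset.sum_range_one, Finset.sum_range_one]
    simp [h1]
  | one =>
    rw [Finset.sum_range_succ, Finset.sum_range_one, Finset.sum_range_succ, Finset.sum_range_one]
    simpa [add_comm] using cubeRootCount_prime_pow_succ hp 0
  | more k ih _ =>
    rw [Finset.sum_range_succ', Finset.sum_range_succ', Finset.sum_range_succ _ (k + 2),
      Finset.sum_range_succ _ (k + 1), ← ih]
    have := cubeRootCount_prime_pow_succ hp (k + 1)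
    simp [Nat.even_add_one] at this ⊢
    rw [this]; ring

/-- Solutions of `A x² + B x y + C y² = n` in integers. -/
abbrev BinaryReps (A B C n : ℤ) : Type :=
  {p : ℤ × ℤ // A * p.1 ^ 2 + B * p.1 * p.2 + C * p.2 ^ 2 = n}

/-- Replacing `x` by `x + k y` transports representations. -/
def binaryRepsShift (A B C n k : ℤ) :
    BinaryReps A (B + 2 * A * k) (C + B * k + A * k ^ 2) n ≃ BinaryReps A B C n where
  toFun p := ⟨(p.1.1 + k * p.1.2, p.1.2), by linear_combination p.2⟩
  invFun p := ⟨(p.1.1 - k * p.1.2, p.1.2), by linear_combination p.2⟩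
  left_inv p := by ext <;> simp
  right_inv p := by ext <;> simp

/-- Exchanging the variables transports representations. -/
def binaryRepsSwap (A B C n : ℤ) : BinaryReps C B A n ≃ BinaryReps A B C n where
  toFun p := ⟨(p.1.2, p.1.1), by linear_combination p.2⟩
  invFun p := ⟨(p.1.2, p.1.1), by linear_combination p.2⟩
  left_inv p := by ext <;> simp
  right_inv p := by ext <;> simp

lemma card_binaryReps_one_one_one_one : Nat.card (BinaryReps 1 1 1 1) = 6 := by
  have : ∀ p : ℤ × ℤ, 1 * p.1 ^ 2 + 1 * p.1 * p.2 + 1 * p.2 ^ 2 = 1 ↔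
      p ∈ ({(1, 0), (-1, 0), (0, 1), (0, -1), (1, -1), (-1, 1)} : Finset (ℤ × ℤ)) := by
    rintro ⟨x, y⟩
    constructor
    · intro h
      simp only at h
      have hx : -1 ≤ x ∧ x ≤ 1 := by
        constructor <;> nlinarith [sq_nonneg (x + 2 * y)]
      have hy : -1 ≤ y ∧ y ≤ 1 := by
        constructor <;> nlinarith [sq_nonneg (2 * x + y)]
      obtain ⟨hx1, hx2⟩ := hx
      obtain ⟨hy1, hy2⟩ := hy
      interval_cases x <;> interval_cases y <;> simp_all
    · intro h
      simp only [Finset.mem_insert, Finset.mem_singleton, Prod.mk.injEq] at h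
      rcases h with ⟨rfl, rfl⟩ | ⟨rfl, rfl⟩ | ⟨rfl, rfl⟩ | ⟨rfl, rfl⟩ | ⟨rfl, rfl⟩ | ⟨rfl, rfl⟩ <;>
        norm_num
  rw [Nat.card_congr (Equiv.subtypeEquivRight this), Nat.card_eq_fintype_card, Fintype.card_coe]
  rfl

/-- Every positive definite form of discriminant `-3` represents `1` exactly six times. -/
lemma card_binaryReps_one {A B C : ℤ} (hA : 0 < A) (h : B ^ 2 - 4 * A * C = -3) :
    Nat.card (BinaryReps A B C 1) = 6 := by
  obtain ⟨n, hn⟩ : ∃ n : ℕ, A ≤ n := ⟨A.toNat, Int.self_le_toNat A⟩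
  induction n generalizing A B C with
  | zero => simp at hn; omega
  | succ n ih =>
    obtain ⟨k, hk1, hk2⟩ : ∃ k : ℤ, -A ≤ B + 2 * A * k ∧ B + 2 * A * k ≤ A := by
      refine ⟨-((B + A) / (2 * A)), ?_, ?_⟩
      · have := Int.mul_ediv_self_le (x := B + A) (k := 2 * A) (by omega)
        linarith
      · have := Int.lt_mul_ediv_self_add (x := B + A) (k := 2 * A) (by omega)
        linarith
    rw [← Nat.card_congr (binaryRepsShift A B C 1 k)]
    have h' : (B + 2 * A * k) ^ 2 - 4 * A * (C + B * k + A * k ^ 2) = -3 := by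
      linear_combination h
    generalize B + 2 * A * k = B' at *
    generalize C + B * k + A * k ^ 2 = C' at *
    have hsq : B' ^ 2 ≤ A ^ 2 := sq_le_sq' hk1 hk2
    rcases eq_or_ne A 1 with rfl | hA1
    · have hB : B' = -1 ∨ B' = 0 ∨ B' = 1 := by omega
      rcases hB with rfl | rfl | rfl
      · obtain rfl : C' = 1 := by omega
        exact (Nat.card_congr (binaryRepsShift 1 (-1) 1 1 1)).symm.trans
          card_binaryReps_one_one_one_one
      · omega
      · obtain rfl : C' = 1 := by omega
        exact card_binaryReps_one_one_one_one
    · have hA2 : 2 ≤ A := by omega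
      have hC0 : 0 < C' := by nlinarith [sq_nonneg B']
      have hCA : C' < A := by nlinarith
      rw [← Nat.card_congr (binaryRepsSwap A B' C' 1)]
      exact ih hC0 (by linear_combination h') (by push_cast at hn; omega)

/-- Primitive representations by `x² + xy + y²`. -/
abbrev PrimitiveHexReps (n : ℕ) : Type :=
  {p : ℤ × ℤ // p.1 ^ 2 + p.1 * p.2 + p.2 ^ 2 = n ∧ IsCoprime p.1 p.2}

lemma exists_root_quotient {n : ℕ} [NeZero n] (b : {b : ZMod n // b ^ 2 + b + 1 = 0}) :
    ∃ c : ℤ, (b.1.val : ℤ) ^ 2 + b.1.val + 1 = n * c := by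
  have h : ((((b.1.val : ℤ) ^ 2 + b.1.val + 1 : ℤ)) : ZMod n) = 0 := by
    push_cast
    rw [ZMod.natCast_zmod_val]
    exact b.2
  exact (ZMod.intCast_zmod_eq_zero_iff_dvd _ _).1 h

/-- Primitive representations of `n` fall into classes indexed by the roots of `X² + X + 1`
modulo `n`, each of them in bijection with the representations of `1` by a form of
discriminant `-3`. -/
lemma card_primitiveHexReps {n : ℕ} (hn : n ≠ 0) :
    (Nat.card (PrimitiveHexReps n) : ℤ) = 6 * cubeRootCount n := by
  have : NeZero n := ⟨hn⟩
  choose c hc using exists_root_quotient (n := n)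
  let f : (Σ b : {b : ZMod n // b ^ 2 + b + 1 = 0}, BinaryReps n (2 * b.1.val + 1) (c b) 1) →
      PrimitiveHexReps n := fun q =>
    ⟨(q.1.1.val * q.2.1.2 + n * q.2.1.1, q.2.1.2), by
      obtain ⟨b, ⟨t, y⟩, h⟩ := q
      have hb := hc b
      simp only at h ⊢
      refine ⟨?_, t, (b.1.val + 1) * t + c b * y, ?_⟩
      · linear_combination n * h + y ^ 2 * hb
      · linear_combination h⟩
  have hf : Function.Bijective f := by
    constructor
    · rintro ⟨b, ⟨t, y⟩, h⟩ ⟨b', ⟨t', y'⟩, h'⟩ he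
      have he' := congrArg Subtype.val he
      simp only [f, Prod.mk.injEq] at he' h h'
      obtain ⟨h1, rfl⟩ := he'
      have hu : (y : ZMod n) * ((2 * b.1 + 1) * t + c b * y) = 1 := by
        have := congrArg (Int.cast : ℤ → ZMod n) h
        push_cast at this
        rw [ZMod.natCast_zmod_val, ZMod.natCast_self] at this
        linear_combination this
      have h2 : b.1 * (y : ZMod n) = b'.1 * y := by
        have := congrArg (Int.cast : ℤ → ZMod n) h1
        push_cast at this
        rw [ZMod.natCast_zmod_val, ZMod.natCast_zmod_val, ZMod.natCast_self] at this
        linear_combination this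
      have h3 : b.1 = b'.1 := by
        linear_combination ((2 * b.1 + 1) * t + c b * y) * h2 - (b.1 - b'.1) * hu
      obtain rfl : b = b' := Subtype.ext h3
      obtain rfl : t = t' :=
        mul_left_cancel₀ (Nat.cast_ne_zero.2 hn : (n : ℤ) ≠ 0) (add_left_cancel h1)
      rfl
    · rintro ⟨⟨x, y⟩, h, hco⟩
      simp only at h hco
      have hyn : IsCoprime y (n : ℤ) := by
        rw [← h, show x ^ 2 + x * y + y ^ 2 = x ^ 2 + y * (x + y) by ring]
        exact (hco.symm.pow_right).add_mul_left_right _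
      obtain ⟨u, v, huv⟩ := hyn
      have huv' : (u : ZMod n) * y = 1 := by
        have := congrArg (Int.cast : ℤ → ZMod n) huv
        push_cast at this
        rwa [ZMod.natCast_self, mul_zero, add_zero] at this
      have h' : (x : ZMod n) ^ 2 + x * y + y ^ 2 = 0 := by
        have := congrArg (Int.cast : ℤ → ZMod n) h
        push_cast at this
        rwa [ZMod.natCast_self] at this
      let b : {b : ZMod n // b ^ 2 + b + 1 = 0} := ⟨x * u, by
        linear_combination (u : ZMod n) ^ 2 * h' - (x * u + u * y + 1) * huv'⟩
      have hd : (n : ℤ) ∣ x - b.1.val * y := by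
        rw [← ZMod.intCast_zmod_eq_zero_iff_dvd]
        push_cast
        rw [ZMod.natCast_zmod_val]
        simp only [b]
        linear_combination -(x : ZMod n) * huv'
      obtain ⟨t, ht⟩ := hd
      refine ⟨⟨b, ⟨(t, y), ?_⟩⟩, ?_⟩
      · refine mul_left_cancel₀ (Nat.cast_ne_zero.2 hn : (n : ℤ) ≠ 0) ?_
        have hb := hc b
        simp only
        linear_combination h - y ^ 2 * hb - (n * t + b.1.val * y + x + y) * ht
      · simp only [f, Subtype.mk.injEq, Prod.mk.injEq, and_true]
        linear_combination -ht
  have h6 : ∀ b, Nat.card (BinaryReps n (2 * (ZMod.val b.1 : ℤ) + 1) (c b) 1) = 6 := fun b =>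
    card_binaryReps_one (by positivity) (by linear_combination 4 * hc b)
  have : ∀ b, Finite (BinaryReps n (2 * (ZMod.val b.1 : ℤ) + 1) (c b) 1) := fun b =>
    Nat.finite_of_card_ne_zero (by rw [h6]; norm_num)
  rw [← Nat.card_congr (Equiv.ofBijective f hf), Nat.card_sigma, cubeRootCount_apply]
  simp only [h6, Finset.sum_const, Finset.card_univ, smul_eq_mul, Nat.card_eq_fintype_card]
  push_cast
  ring

/-- Representations by `x² + xy + y²`. -/
abbrev HexReps (n : ℕ) : Type := {p : ℤ × ℤ // p.1 ^ 2 + p.1 * p.2 + p.2 ^ 2 = n}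

instance finite_hexReps (n : ℕ) : Finite (HexReps n) := by
  refine Set.Finite.to_subtype (Set.Finite.subset
    ((Set.finite_Icc (-(2 * n : ℤ)) (2 * n)).prod (Set.finite_Icc (-(2 * n : ℤ)) (2 * n))) ?_)
  rintro ⟨x, y⟩ h
  change x ^ 2 + x * y + y ^ 2 = (n : ℤ) at h
  have key : ∀ z : ℤ, z ^ 2 ≤ 2 * n → -(2 * n : ℤ) ≤ z ∧ z ≤ 2 * n := fun z hz =>
    ⟨by nlinarith [sq_nonneg (z + 1)], by nlinarith [sq_nonneg (z - 1)]⟩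
  exact ⟨key x (by nlinarith [sq_nonneg (x + 2 * y)]), key y (by nlinarith [sq_nonneg (2 * x + y)])⟩

instance finite_primitiveHexReps (n : ℕ) : Finite (PrimitiveHexReps n) :=
  Finite.of_injective (fun p => (⟨p.1, p.2.1⟩ : HexReps n)) fun _ _ h =>
    Subtype.ext (Subtype.mk.inj h)

lemma card_hexReps {n : ℕ} (hn : n ≠ 0) :
    (Nat.card (HexReps n) : ℤ) = 6 * ∑ d ∈ n.divisors, chiThree d := by
  classical
  let F : Finset (ℕ × ℕ) := n.divisorsAntidiagonal.filter fun x => IsSquare x.1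
  have hF : ∀ x : F, x.1.1.sqrt * x.1.1.sqrt = x.1.1 := by
    rintro ⟨⟨a, m⟩, hx⟩
    obtain ⟨g, rfl⟩ := (Finset.mem_filter.1 hx).2
    simp [Nat.sqrt_eq]
  have hmul : ∀ x : F, x.1.1 * x.1.2 = n := fun x =>
    (Nat.mem_divisorsAntidiagonal.1 (Finset.mem_filter.1 x.2).1).1
  let f : (Σ x : F, PrimitiveHexReps x.1.2) → HexReps n := fun q =>
    ⟨(q.1.1.1.sqrt * q.2.1.1, q.1.1.1.sqrt * q.2.1.2), by
      have h1 : ((q.1.1.1.sqrt : ℤ) * q.1.1.1.sqrt) * q.1.1.2 = n := by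
        exact_mod_cast (hF q.1).symm ▸ hmul q.1
      linear_combination (q.1.1.1.sqrt : ℤ) ^ 2 * q.2.2.1 + h1⟩
  have hf : Function.Bijective f := by
    constructor
    · rintro ⟨x, p, hp, hco⟩ ⟨x', p', hp', hco'⟩ he
      have he' := congrArg Subtype.val he
      simp only [f, Prod.mk.injEq] at he'
      have hg : x.1.1.sqrt = x'.1.1.sqrt := by
        have h1 := Int.gcd_mul_left (x.1.1.sqrt : ℤ) p.1 p.2
        have h2 := Int.gcd_mul_left (x'.1.1.sqrt : ℤ) p'.1 p'.2
        rw [Int.isCoprime_iff_gcd_eq_one.1 hco] at h1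
        rw [Int.isCoprime_iff_gcd_eq_one.1 hco'] at h2
        rw [he'.1, he'.2, h2] at h1
        simpa using h1.symm
      have h1 : x.1.1 = x'.1.1 := by rw [← hF x, ← hF x', hg]
      have hx0 : x.1.1 ≠ 0 := fun h => hn (by rw [← hmul x, h, zero_mul])
      obtain rfl : x = x' := Subtype.ext (Prod.ext h1 (Nat.eq_of_mul_eq_mul_left
        (Nat.pos_of_ne_zero hx0) (by rw [hmul x, h1, hmul x'])))
      have hs : (x.1.1.sqrt : ℤ) ≠ 0 := by
        intro h
        have h' : x.1.1.sqrt = 0 := by exact_mod_cast h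
        exact hx0 (by rw [← hF x, h', zero_mul])
      obtain rfl : p = p' :=
        Prod.ext (mul_left_cancel₀ hs he'.1) (mul_left_cancel₀ hs he'.2)
      rfl
    · rintro ⟨⟨x, y⟩, h⟩
      simp only at h
      have hxy : 0 < Int.gcd x y := by
        rw [Int.gcd_pos_iff]
        by_contra! h0
        obtain ⟨rfl, rfl⟩ := h0
        exact hn (by exact_mod_cast h.symm)
      obtain ⟨x', y', hco, hx, hy⟩ := Int.exists_gcd_one hxy
      set g := Int.gcd x y with hgdef
      have hm : x' ^ 2 + x' * y' + y' ^ 2 = ((x' ^ 2 + x' * y' + y' ^ 2).toNat : ℤ) := by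
        rw [Int.toNat_of_nonneg]
        nlinarith [sq_nonneg (x' + y'), sq_nonneg x', sq_nonneg y']
      have hgm : g * g * (x' ^ 2 + x' * y' + y' ^ 2).toNat = n := by
        zify
        rw [← hm, ← h, hx, hy]
        ring
      refine ⟨⟨⟨(g * g, (x' ^ 2 + x' * y' + y' ^ 2).toNat), ?_⟩, ⟨(x', y'), hm, ?_⟩⟩, ?_⟩
      · simp [F, hgm, hn]
      · exact Int.isCoprime_iff_gcd_eq_one.2 hco
      · simp [f, Nat.sqrt_eq]
        exact ⟨by rw [mul_comm, ← hx], by rw [mul_comm, ← hy]⟩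
  rw [← Nat.card_congr (Equiv.ofBijective f hf), Nat.card_sigma,
    ← ArithmeticFunction.coe_mul_zeta_apply, ← squareIndicator_mul_cubeRootCount,
    ArithmeticFunction.mul_apply, Finset.mul_sum]
  push_cast
  rw [Finset.sum_coe_sort F fun x => (Nat.card (PrimitiveHexReps x.2) : ℤ), Finset.sum_filter]
  refine Finset.sum_congr rfl fun x hx => ?_
  obtain ⟨hxn, -⟩ := Nat.mem_divisorsAntidiagonal.1 hx
  have h1 : x.1 ≠ 0 := fun h => hn (by rw [← hxn, h, zero_mul])
  have h2 : x.2 ≠ 0 := fun h => hn (by rw [← hxn, h, mul_zero])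
  rw [card_primitiveHexReps h2]
  by_cases hs : IsSquare x.1 <;> simp [squareIndicator, hs, h1]

lemma hexForm_pos {p : ℤ × ℤ} (hp : p ≠ 0) : 0 < p.1 ^ 2 + p.1 * p.2 + p.2 ^ 2 := by
  have hp : p.1 ≠ 0 ∨ p.2 ≠ 0 := by
    by_contra! h
    exact hp (Prod.ext h.1 h.2)
  have h4 : 0 < p.1 ^ 2 + p.2 ^ 2 := by
    rcases hp with h | h <;> positivity
  nlinarith [sq_nonneg (p.1 + p.2)]

/-- Nonzero integer pairs, sorted by the value of `x² + xy + y²`. -/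
noncomputable def sigmaHexRepsEquiv : (Σ n : ℕ+, HexReps n) ≃ {p : ℤ × ℤ // p ≠ 0} :=
  Equiv.ofBijective (fun q => ⟨q.2.1, fun h => by
      have := q.2.2
      rw [h] at this
      exact q.1.ne_zero (by simpa using this.symm)⟩) <| by
    constructor
    · rintro ⟨n, p, hp⟩ ⟨n', p', hp'⟩ h
      obtain rfl : p = p' := Subtype.mk.inj h
      obtain rfl : n = n' := PNat.coe_injective (by exact_mod_cast hp.symm.trans hp')
      rfl
    · rintro ⟨p, hp⟩
      have h := hexForm_pos hp
      exact ⟨⟨⟨(p.1 ^ 2 + p.1 * p.2 + p.2 ^ 2).toNat, by omega⟩,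
        ⟨p, by rw [PNat.mk_coe, Int.toNat_of_nonneg h.le]⟩⟩, rfl⟩

lemma tsum_chiThree_mul {a : ℕ → ℝ} (h : Summable fun n : ℕ+ => (chiThree n : ℝ) * a n) :
    ∑' n : ℕ+, (chiThree n : ℝ) * a n = ∑' n : ℕ, (a (3 * n + 1) - a (3 * n + 2)) := by
  have hsupp : ∀ n ∉ Set.range ((↑) : ℕ+ → ℕ), (chiThree n : ℝ) * a n = 0 := by
    intro n hn
    have : n = 0 := by
      by_contra h0
      exact hn ⟨⟨n, Nat.pos_of_ne_zero h0⟩, rfl⟩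
    simp [this]
  have hs : Summable fun n : ℕ => (chiThree n : ℝ) * a n :=
    (PNat.coe_injective.summable_iff hsupp).1 h
  have hsum : ∑' n : ℕ+, (chiThree n : ℝ) * a n = ∑' n : ℕ, (chiThree n : ℝ) * a n :=
    PNat.coe_injective.tsum_eq (f := fun n : ℕ => (chiThree n : ℝ) * a n) fun n hn => by
      by_contra h0
      exact hn (hsupp n h0)
  have hinj : ∀ j, Function.Injective fun n : ℕ => 3 * n + j := fun j m n hmn => by
    simp only at hmn
    omega
  have h1 := hs.comp_injective (hinj 1)
  have h2 := hs.comp_injective (hinj 2)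
  have e1 : ∀ n : ℕ, chiThree (3 * n + 1) = 1 := fun n => by
    rw [chiThree_apply, if_pos (by omega)]
  have e2 : ∀ n : ℕ, chiThree (3 * n + 2) = -1 := fun n => by
    rw [chiThree_apply, if_neg (by omega), if_pos (by omega)]
  have e0 : ∀ n : ℕ, chiThree (3 * n) = 0 := fun n => by
    rw [chiThree_apply, if_neg (by omega), if_neg (by omega)]
  simp only [Function.comp_def, e1, e2, Int.cast_one, one_mul, Int.cast_neg, neg_mul] at h1 h2
  rw [hsum, Nat.sumByResidueClasses hs 3]
  have hfin : ∀ f : ZMod 3 → ℝ, ∑ j, f j = f 0 + f 1 + f 2 := fun f => Fin.sum_univ_three f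
  rw [hfin, show (0 : ZMod 3).val = 0 from rfl, show (1 : ZMod 3).val = 1 from rfl,
    show (2 : ZMod 3).val = 2 from rfl]
  simp only [add_comm _ (3 * _), add_zero, e0, e1, e2, Int.cast_zero, zero_mul, tsum_zero,
    Int.cast_one, one_mul, Int.cast_neg, neg_mul, zero_add, sub_eq_add_neg]
  exact (h1.tsum_add h2).symm

lemma tsum_hex_eq {F : ℕ → ℝ} (hF : ∀ n, 0 ≤ F n)
    (hs : Summable fun c : ℕ+ × ℕ+ => F (c.1 * c.2)) :
    ∑' p : {p : ℤ × ℤ // p ≠ 0}, F (p.1.1 ^ 2 + p.1.1 * p.1.2 + p.1.2 ^ 2).toNat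
      = 6 * ∑' n : ℕ, (∑' m : ℕ+, F ((3 * n + 1) * m) - ∑' m : ℕ+, F ((3 * n + 2) * m)) := by
  have hchi : ∀ n, |(chiThree n : ℝ)| ≤ 1 := by
    intro n
    rw [chiThree_apply]
    split_ifs <;> simp
  have hs' : Summable fun c : ℕ+ × ℕ+ => (chiThree c.1 : ℝ) * F (c.1 * c.2) := by
    refine Summable.of_norm_bounded hs fun c => ?_
    rw [norm_mul, Real.norm_eq_abs, Real.norm_eq_abs, abs_of_nonneg (hF _)]
    exact mul_le_of_le_one_left (hF _) (hchi _)
  have hcard : ∀ n : ℕ+, ∑' x : Nat.divisorsAntidiagonal n,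
      (chiThree (sigmaAntidiagonalEquivProd ⟨n, x⟩).1 : ℝ) *
        F ((sigmaAntidiagonalEquivProd ⟨n, x⟩).1 * (sigmaAntidiagonalEquivProd ⟨n, x⟩).2)
      = (Nat.card (HexReps n) : ℝ) / 6 * F n := by
    intro n
    have h6 : (Nat.card (HexReps n) : ℝ) = 6 * ∑ d ∈ (n : ℕ).divisors, (chiThree d : ℝ) := by
      exact_mod_cast card_hexReps n.ne_zero
    have hval : ∀ x : Nat.divisorsAntidiagonal n,
        (chiThree (sigmaAntidiagonalEquivProd ⟨n, x⟩).1 : ℝ) *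
          F ((sigmaAntidiagonalEquivProd ⟨n, x⟩).1 * (sigmaAntidiagonalEquivProd ⟨n, x⟩).2)
        = (chiThree x.1.1 : ℝ) * F n := by
      intro x
      rw [show ((sigmaAntidiagonalEquivProd ⟨n, x⟩).1 : ℕ) = x.1.1 from rfl,
        show ((sigmaAntidiagonalEquivProd ⟨n, x⟩).2 : ℕ) = x.1.2 from rfl,
        (Nat.mem_divisorsAntidiagonal.1 x.2).1]
    rw [tsum_congr hval, tsum_fintype,
      Finset.sum_coe_sort (Nat.divisorsAntidiagonal n) fun x => (chiThree x.1 : ℝ) * F n,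
      Nat.sum_divisorsAntidiagonal (f := fun d _ => (chiThree d : ℝ) * F n), h6,
      ← Finset.sum_mul]
    ring
  have hs6 : Summable fun n : ℕ+ => (Nat.card (HexReps n) : ℝ) / 6 * F n := by
    have := (sigmaAntidiagonalEquivProd.summable_iff.2 hs').sigma
    exact this.congr hcard
  have hsig : ∀ q : (Σ n : ℕ+, HexReps n), F (q.2.1.1 ^ 2 + q.2.1.1 * q.2.1.2 + q.2.1.2 ^ 2).toNat
      = F q.1 := fun q => by rw [q.2.2, Int.toNat_natCast]
  have hsum : Summable fun q : (Σ n : ℕ+, HexReps n) => F q.1 := by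
    rw [summable_sigma_of_nonneg fun q => hF _]
    refine ⟨fun n => ?_, ?_⟩
    · have := Fintype.ofFinite (HexReps n)
      exact (hasSum_fintype _).summable
    · simp only [tsum_const, nsmul_eq_mul]
      exact (hs6.mul_left 6).congr fun n => by ring
  rw [← sigmaHexRepsEquiv.tsum_eq]
  calc _ = ∑' q : (Σ n : ℕ+, HexReps n), F q.1 := tsum_congr hsig
    _ = ∑' n : ℕ+, (Nat.card (HexReps n) : ℝ) * F n := by
      rw [hsum.tsum_sigma]
      simp
    _ = 6 * ∑' n : ℕ+, (Nat.card (HexReps n) : ℝ) / 6 * F n := by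
      rw [← tsum_mul_left]
      exact tsum_congr fun n => by ring
    _ = 6 * ∑' c : ℕ+ × ℕ+, (chiThree c.1 : ℝ) * F (c.1 * c.2) := by
      rw [← sigmaAntidiagonalEquivProd.tsum_eq]
      refine congrArg _ (Eq.trans ?_ (sigmaAntidiagonalEquivProd.summable_iff.2 hs').tsum_sigma.symm)
      exact tsum_congr fun n => (hcard n).symm
    _ = 6 * ∑' d : ℕ+, (chiThree d : ℝ) * ∑' m : ℕ+, F (d * m) := by
      rw [hs'.tsum_prod]
      simp only [tsum_mul_left]
    _ = _ := by
      rw [tsum_chiThree_mul (a := fun d => ∑' m : ℕ+, F (d * m))]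
      simpa only [tsum_mul_left] using hs'.prod

section ConvexSequence

variable {u : ℕ → ℝ}

lemma nonneg_of_antitone_sub (hu : Antitone fun i => u i - u (i + 1)) (h0 : Tendsto u atTop (𝓝 0))
    (i : ℕ) : 0 ≤ u i - u (i + 1) := by
  have : Tendsto (fun i => u i - u (i + 1)) atTop (𝓝 0) := by
    simpa using h0.sub (h0.comp (tendsto_add_atTop_nat 1))
  exact hu.le_of_tendsto this i

lemma hasSum_telescope (hu : Antitone fun i => u i - u (i + 1)) (h0 : Tendsto u atTop (𝓝 0))
    {k : ℕ} (hk : 0 < k) (c : ℕ) :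
    HasSum (fun n => u (k * n + c) - u (k * (n + 1) + c)) (u c) := by
  have hanti : Antitone u := antitone_nat_of_succ_le fun i =>
    sub_nonneg.1 (nonneg_of_antitone_sub hu h0 i)
  rw [hasSum_iff_tendsto_nat_of_nonneg]
  · have h1 : Tendsto (fun n => u (k * n + c)) atTop (𝓝 0) :=
      h0.comp (tendsto_atTop_mono
        (fun n => (Nat.le_mul_of_pos_left n hk).trans (Nat.le_add_right _ c)) tendsto_id)
    have h2 := h1.const_sub (u c)
    rw [sub_zero] at h2
    refine h2.congr fun n => ?_
    rw [Finset.sum_range_sub' fun n => u (k * n + c)]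
    simp
  · exact fun n => sub_nonneg.2 (hanti (by nlinarith))

lemma sub_le_mul_sub (hu : Antitone fun i => u i - u (i + 1)) (k i : ℕ) :
    u i - u (i + k) ≤ k * (u i - u (i + 1)) := by
  have h := Finset.sum_range_sub' (fun j => u (i + j)) k
  simp only [add_zero] at h
  rw [← h]
  have := Finset.sum_le_card_nsmul (Finset.range k) (fun j => u (i + j) - u (i + (j + 1)))
    (u i - u (i + 1)) fun j _ => hu (Nat.le_add_right i j)
  rwa [Finset.card_range, nsmul_eq_mul] at this

lemma mul_sub_le_sub (hu : Antitone fun i => u i - u (i + 1)) (k i : ℕ) :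
    (k + 1) * (u (i + k) - u (i + k + 1)) ≤ u i - u (i + k + 1) := by
  have h := Finset.sum_range_sub' (fun j => u (i + j)) (k + 1)
  simp only [add_zero, ← add_assoc] at h
  rw [← h]
  have := Finset.card_nsmul_le_sum (Finset.range (k + 1)) (fun j => u (i + j) - u (i + j + 1))
    (u (i + k) - u (i + k + 1)) fun j hj => hu (by simp at hj; omega)
  simpa using this

lemma mul_sub_le_shift (hu : Antitone fun i => u i - u (i + 1)) {k : ℕ} (hk : 0 < k) (n : ℕ) :
    u (k * (n + 1)) - u (k * (n + 1) + 1)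
      ≤ (k : ℝ)⁻¹ * (u (k * n + 1) - u (k * (n + 1) + 1)) := by
  obtain ⟨l, rfl⟩ := Nat.exists_eq_add_of_le' hk
  have := mul_sub_le_sub hu l ((l + 1) * n + 1)
  rw [show (l + 1) * n + 1 + l = (l + 1) * (n + 1) by ring] at this
  rw [← div_eq_inv_mul, le_div_iff₀ (by positivity)]
  push_cast
  linarith

lemma summable_sub_of_convex (hu : Antitone fun i => u i - u (i + 1)) (h0 : Tendsto u atTop (𝓝 0))
    {k : ℕ} (hk : 0 < k) : Summable fun n => u (k * n) - u (k * n + 1) := by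
  rw [← summable_nat_add_iff 1]
  exact Summable.of_nonneg_of_le (fun n => nonneg_of_antitone_sub hu h0 _)
    (fun n => mul_sub_le_shift hu hk n) ((hasSum_telescope hu h0 hk 1).summable.mul_left _)

lemma le_tsum_sub_of_convex (hu : Antitone fun i => u i - u (i + 1)) (h0 : Tendsto u atTop (𝓝 0))
    {k : ℕ} (hk : 0 < k) (N : ℕ) :
    (∑ n ∈ Finset.range N, (u (k * n) - u (k * n + 1))) + (k : ℝ)⁻¹ * u (k * N)
      ≤ ∑' n, (u (k * n) - u (k * n + 1)) := by
  have hs := summable_sub_of_convex hu h0 hk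
  rw [← hs.sum_add_tsum_nat_add N]
  gcongr
  have h1 := (hasSum_telescope hu h0 hk (k * N)).mul_left (k : ℝ)⁻¹
  rw [← h1.tsum_eq]
  refine h1.summable.tsum_le_tsum (fun n => ?_) ((summable_nat_add_iff N).2 hs)
  have := sub_le_mul_sub hu k (k * (n + N))
  rw [← div_eq_inv_mul, div_le_iff₀' (by positivity)]
  rwa [show k * (n + N) + k = k * (n + 1) + k * N by ring, show k * (n + N) = k * n + k * N by ring]
    at *

lemma tsum_sub_le_of_convex (hu : Antitone fun i => u i - u (i + 1)) (h0 : Tendsto u atTop (𝓝 0))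
    {k : ℕ} (hk : 0 < k) (N : ℕ) :
    ∑' n, (u (k * n) - u (k * n + 1)) ≤
    (∑ n ∈ Finset.range (N + 1), (u (k * n) - u (k * n + 1))) + (k : ℝ)⁻¹ * u (k * N + 1) := by
  have hs := summable_sub_of_convex hu h0 hk
  rw [← hs.sum_add_tsum_nat_add (N + 1)]
  gcongr
  have h1 := (hasSum_telescope hu h0 hk (k * N + 1)).mul_left (k : ℝ)⁻¹
  rw [← h1.tsum_eq]
  refine ((summable_nat_add_iff (N + 1)).2 hs).tsum_le_tsum (fun n => ?_) h1.summable
  have := mul_sub_le_shift hu hk (n + N)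
  rw [show k * n + (k * N + 1) = k * (n + N) + 1 by ring,
    show k * (n + 1) + (k * N + 1) = k * (n + N + 1) + 1 by ring]
  exact this

end ConvexSequence

lemma tendsto_log_prod_sub {k : ℕ} (hk : 0 < k) :
    Tendsto (fun N : ℕ => (∑ n ∈ Finset.range (N + 1),
        (log (k * n + 2) - log (k * n + 1))) - (k : ℝ)⁻¹ * log N) atTop
      (𝓝 (log (Gamma (1 / k)) - log (Gamma (2 / k)))) := by
  have h1 : (0 : ℝ) < 1 / k := by positivity
  have h2 : (0 : ℝ) < 2 / k := by positivity
  have g1 := (Real.GammaSeq_tendsto_Gamma (1 / k)).log (Gamma_pos_of_pos h1).ne'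
  have g2 := (Real.GammaSeq_tendsto_Gamma (2 / k)).log (Gamma_pos_of_pos h2).ne'
  have hlog : ∀ s : ℝ, 0 < s → ∀ N : ℕ, N ≠ 0 → log (Real.GammaSeq s N) =
      s * log N + log (N.factorial) - ∑ n ∈ Finset.range (N + 1), log (s + n) := by
    intro s hs N hN
    have hN' : (0 : ℝ) < N := by positivity
    have hpos : ∀ n ∈ Finset.range (N + 1), s + n ≠ 0 := fun n _ => by positivity
    rw [Real.GammaSeq, log_div (by positivity) (Finset.prod_ne_zero_iff.2 hpos),
      log_mul (by positivity) (by positivity), log_rpow hN', log_prod hpos]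
  refine (g1.sub g2).congr' ?_
  filter_upwards [eventually_ne_atTop 0] with N hN
  rw [hlog _ h1 N hN, hlog _ h2 N hN]
  have hk' : (0 : ℝ) < k := by positivity
  have e : ∀ c : ℝ, 0 < c → ∀ n : ℕ, log (c / k + n) = log (k * n + c) - log k := by
    intro c hc n
    rw [← log_div (by positivity) (by positivity)]
    congr 1
    field_simp
    ring
  simp only [e 1 one_pos, e 2 two_pos, Finset.sum_sub_distrib]
  field_simp
  ring

lemma tendsto_log_linear_sub {k c : ℝ} (hk : 0 < k) (hc : 0 < c) :
    Tendsto (fun N : ℕ => log (k * N + c) - log N) atTop (𝓝 (log k)) := by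
  have h : Tendsto (fun N : ℕ => k + c / N) atTop (𝓝 k) := by
    simpa using (tendsto_const_div_atTop_nhds_zero_nat c).const_add k
  refine (h.log hk.ne').congr' ?_
  filter_upwards [eventually_ne_atTop 0] with N hN
  have : (0 : ℝ) < N := by positivity
  rw [← log_div (by positivity) (by positivity)]
  congr 1
  field_simp

lemma tendsto_of_bounds {f : ℝ → ℝ} {l : Filter ℝ} {lo hi : ℕ → ℝ → ℝ} {a b : ℕ → ℝ} {L : ℝ}
    (hlo : ∀ N, ∀ᶠ x in l, lo N x ≤ f x) (hhi : ∀ N, ∀ᶠ x in l, f x ≤ hi N x)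
    (ha : ∀ N, Tendsto (lo N) l (𝓝 (a N))) (hb : ∀ N, Tendsto (hi N) l (𝓝 (b N)))
    (hal : Tendsto a atTop (𝓝 L)) (hbl : Tendsto b atTop (𝓝 L)) : Tendsto f l (𝓝 L) := by
  rw [tendsto_order]
  constructor
  · intro c hc
    obtain ⟨N, hN⟩ := (hal.eventually_const_lt hc).exists
    filter_upwards [hlo N, (ha N).eventually_const_lt hN] with x h1 h2 using h2.trans_le h1
  · intro c hc
    obtain ⟨N, hN⟩ := (hbl.eventually_lt_const hc).exists
    filter_upwards [hhi N, (hb N).eventually_lt_const hN] with x h1 h2 using h1.trans_lt h2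

/-- If a convex function `H` vanishing at infinity behaves like `-α log x + β` at `0`, this is the
expansion at `0` of `∑ₙ (H(ε(kn+1)) - H(ε(kn+2)))`. -/
lemma tendsto_tsum_sub_add_log {H : ℝ → ℝ} {α β : ℝ} {k : ℕ} (hk : 0 < k)
    (hinf : Tendsto H atTop (𝓝 0))
    (hconv : ∀ x y ε, 0 < x → x ≤ y → 0 ≤ ε → H y - H (y + ε) ≤ H x - H (x + ε))
    (hzero : Tendsto (fun x => H x + α * log x) (𝓝[>] 0) (𝓝 β)) :
    Tendsto (fun ε : ℝ => (∑' n : ℕ, (H (ε * (k * n + 1)) - H (ε * (k * n + 2))))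
        + α / k * log ε) (𝓝[>] 0)
      (𝓝 (β / k + α * (log (Gamma (1 / k)) - log (Gamma (2 / k)) - log k / k))) := by
  have hk' : (0 : ℝ) < k := by positivity
  let u : ℝ → ℕ → ℝ := fun ε i => H (ε * (i + 1))
  have hu : ∀ ε, 0 < ε → Antitone fun i => u ε i - u ε (i + 1) := by
    intro ε hε i j hij
    have := hconv (ε * (i + 1)) (ε * (j + 1)) ε (by positivity) (by gcongr) hε.le
    simpa [u, mul_add, add_assoc] using this
  have hu0 : ∀ ε, 0 < ε → Tendsto (u ε) atTop (𝓝 0) := fun ε hε =>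
    hinf.comp ((tendsto_natCast_atTop_atTop.atTop_add tendsto_const_nhds).const_mul_atTop hε)
  have hT : ∀ ε, ∑' n : ℕ, (H (ε * (k * n + 1)) - H (ε * (k * n + 2)))
      = ∑' n : ℕ, (u ε (k * n) - u ε (k * n + 1)) := by
    intro ε
    refine tsum_congr fun n => ?_
    simp only [u]
    congr 3 <;> (push_cast; ring)
  have hlim : ∀ i : ℕ, Tendsto (fun ε => u ε i + α * log ε) (𝓝[>] 0)
      (𝓝 (β - α * log (i + 1))) := by
    intro i
    have hi : (0 : ℝ) < i + 1 := by positivity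
    have h1 : Tendsto (fun ε : ℝ => ε * (i + 1)) (𝓝[>] 0) (𝓝[>] 0) := by
      refine tendsto_nhdsWithin_iff.2 ⟨?_, ?_⟩
      · have : Tendsto (fun ε : ℝ => ε * (i + 1)) (𝓝 0) (𝓝 (0 * (i + 1))) :=
          tendsto_id.mul_const _
        rw [zero_mul] at this
        exact this.mono_left nhdsWithin_le_nhds
      · filter_upwards [self_mem_nhdsWithin] with ε hε using mul_pos hε hi
    refine ((hzero.comp h1).sub_const (α * log (i + 1))).congr' ?_
    filter_upwards [self_mem_nhdsWithin] with ε hε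
    simp only [Function.comp, u]
    rw [log_mul (ne_of_gt hε) hi.ne']
    ring
  have hpart : ∀ N : ℕ, Tendsto (fun ε => ∑ n ∈ Finset.range N, (u ε (k * n) - u ε (k * n + 1)))
      (𝓝[>] 0) (𝓝 (α * ∑ n ∈ Finset.range N, (log (k * n + 2) - log (k * n + 1)))) := by
    intro N
    rw [Finset.mul_sum]
    refine tendsto_finsetSum _ fun n _ => ?_
    have := (hlim (k * n)).sub (hlim (k * n + 1))
    convert this using 2
    · ring
    · push_cast
      ring_nf
  simp only [hT]
  have hlog := tendsto_log_prod_sub hk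
  refine tendsto_of_bounds
    (lo := fun N ε => (∑ n ∈ Finset.range (N + 1), (u ε (k * n) - u ε (k * n + 1)))
      + (k : ℝ)⁻¹ * (u ε (k * (N + 1)) + α * log ε))
    (hi := fun N ε => (∑ n ∈ Finset.range (N + 1), (u ε (k * n) - u ε (k * n + 1)))
      + (k : ℝ)⁻¹ * (u ε (k * N + 1) + α * log ε))
    ?_ ?_ (fun N => (hpart (N + 1)).add ((hlim _).const_mul _))
    (fun N => (hpart (N + 1)).add ((hlim _).const_mul _)) ?_ ?_
  · intro N
    filter_upwards [self_mem_nhdsWithin] with ε hε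
    have := le_tsum_sub_of_convex (hu ε hε) (hu0 ε hε) hk (N + 1)
    rw [mul_add, div_mul_eq_mul_div, div_eq_inv_mul]
    linarith
  · intro N
    filter_upwards [self_mem_nhdsWithin] with ε hε
    have := tsum_sub_le_of_convex (hu ε hε) (hu0 ε hε) hk N
    rw [mul_add, div_mul_eq_mul_div, div_eq_inv_mul]
    linarith
  · have h2 := tendsto_log_linear_sub (c := k + 1) hk' (by positivity)
    have := ((hlog.sub (h2.const_mul (k : ℝ)⁻¹)).const_mul α).add_const ((k : ℝ)⁻¹ * β)
    convert this using 2
    · push_cast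
      ring_nf
    · ring_nf
  · have h2 := tendsto_log_linear_sub (c := 2) hk' (by positivity)
    have := ((hlog.sub (h2.const_mul (k : ℝ)⁻¹)).const_mul α).add_const ((k : ℝ)⁻¹ * β)
    convert this using 2
    · push_cast
      ring_nf
    · ring_nf

section TailIntegral

variable {p : ℝ → ℝ}

lemma tendsto_tailIntegral (hpint : ∀ x, 0 < x → IntegrableOn p (Set.Ioi x)) :
    Tendsto (fun x => ∫ t in Set.Ioi x, p t) atTop (𝓝 0) := by
  have h := (intervalIntegral_tendsto_integral_Ioi 1 (hpint 1 one_pos) tendsto_id).const_sub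
    (∫ t in Set.Ioi 1, p t)
  rw [sub_self] at h
  refine h.congr' ?_
  filter_upwards [eventually_ge_atTop 1] with x hx
  rw [id, ← intervalIntegral.integral_Ioi_sub_Ioi (hpint 1 one_pos) hx]
  ring

lemma tailIntegral_sub_le (hpint : ∀ x, 0 < x → IntegrableOn p (Set.Ioi x))
    (hanti : AntitoneOn p (Set.Ioi 0)) (x y ε : ℝ) (hx : 0 < x) (hxy : x ≤ y) (hε : 0 ≤ ε) :
    (∫ t in Set.Ioi y, p t) - (∫ t in Set.Ioi (y + ε), p t) ≤
      (∫ t in Set.Ioi x, p t) - ∫ t in Set.Ioi (x + ε), p t := by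
  have shift : ∀ z, 0 < z → (∫ t in Set.Ioi z, p t) - (∫ t in Set.Ioi (z + ε), p t) =
      ∫ t in 0..ε, p (z + t) := by
    intro z hz
    rw [intervalIntegral.integral_Ioi_sub_Ioi (hpint z hz) (by linarith),
      intervalIntegral.integral_comp_add_left]
    simp
  have hii : ∀ z, 0 < z → IntervalIntegrable (fun t => p (z + t)) volume 0 ε := by
    intro z hz
    apply AntitoneOn.intervalIntegrable
    rw [Set.uIcc_of_le hε]
    intro a ha b hb hab
    exact hanti (show 0 < z + a by linarith [ha.1]) (show 0 < z + b by linarith [hb.1])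
      (by linarith)
  have hy := hx.trans_le hxy
  rw [shift x hx, shift y hy]
  refine intervalIntegral.integral_mono_on hε (hii y hy) (hii x hx) fun t ht => ?_
  exact hanti (show 0 < x + t by linarith [ht.1]) (show 0 < y + t by linarith [ht.1])
    (by linarith)

end TailIntegral

lemma integrableOn_exp_neg_div {x : ℝ} (hx : 0 < x) :
    IntegrableOn (fun t => exp (-t) / t) (Set.Ioi x) := by
  refine ((integrableOn_exp_neg_Ioi x).div_const x).mono' ?_ ?_
  · exact (Measurable.aestronglyMeasurable (by fun_prop))
  · refine (ae_restrict_mem measurableSet_Ioi).mono fun t ht => ?_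
    have ht : x < t := ht
    have := hx.trans ht
    rw [norm_of_nonneg (by positivity)]
    gcongr

lemma antitoneOn_exp_neg_div : AntitoneOn (fun t : ℝ => exp (-t) / t) (Set.Ioi 0) := by
  intro a ha b hb hab
  have ha : 0 < a := ha
  dsimp only
  gcongr

lemma incGamma_nonneg {x : ℝ} (hx : 0 ≤ x) : 0 ≤ incGamma x :=
  setIntegral_nonneg measurableSet_Ioi fun t ht => by
    have : 0 < t := hx.trans_lt ht
    positivity

lemma incGamma_le {x : ℝ} (hx : 0 < x) : incGamma x ≤ exp (-x) / x := by
  have h := integral_exp_neg_Ioi x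
  rw [incGamma, ← h, ← integral_div]
  refine setIntegral_mono_on (integrableOn_exp_neg_div hx)
    ((integrableOn_exp_neg_Ioi x).div_const x) measurableSet_Ioi fun t ht => ?_
  have ht : x < t := ht
  gcongr

lemma integral_log_mul_exp_neg :
    ∫ t in Set.Ioi (0 : ℝ), log t * exp (-t) = -eulerMascheroniConstant := by
  have h1 := Complex.hasDerivAt_GammaIntegral (s := 1) (by simp)
  have h2 := Complex.hasDerivAt_Gamma_one
  have h3 : Complex.GammaIntegral =ᶠ[𝓝 1] Complex.Gamma := by
    have : ∀ᶠ s : ℂ in 𝓝 1, 0 < s.re :=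
      (isOpen_lt continuous_const Complex.continuous_re).mem_nhds (by simp)
    filter_upwards [this] with s hs
    exact (Complex.Gamma_eq_integral hs).symm
  have h4 := (h1.congr_of_eventuallyEq h3.symm).unique h2
  simp only [sub_self, Complex.cpow_zero, one_mul] at h4
  have h5 : (∫ t in Set.Ioi (0 : ℝ), ((log t * exp (-t) : ℝ) : ℂ)) =
      ((-eulerMascheroniConstant : ℝ) : ℂ) := by
    rw [← Complex.ofReal_neg] at h4
    rw [← h4]
    simp
  rw [integral_complex_ofReal] at h5
  exact_mod_cast h5

lemma integrableOn_log_mul_exp_neg :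
    IntegrableOn (fun t : ℝ => log t * exp (-t)) (Set.Ioi 0) := by
  refine Integrable.of_integral_ne_zero ?_
  rw [integral_log_mul_exp_neg]
  linarith [one_half_lt_eulerMascheroniConstant]

lemma incGamma_eq_integral_log {x : ℝ} (hx : 0 < x) :
    incGamma x = (∫ t in Set.Ioi x, log t * exp (-t)) - exp (-x) * log x := by
  have hlog : IntegrableOn (fun t : ℝ => log t * exp (-t)) (Set.Ioi x) :=
    integrableOn_log_mul_exp_neg.mono_set (Set.Ioi_subset_Ioi hx.le)
  have hderiv : ∀ t ∈ Set.Ici x, HasDerivAt (fun t : ℝ => -(exp (-t) * log t))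
      (log t * exp (-t) - exp (-t) / t) t := by
    intro t ht
    have ht0 : t ≠ 0 := (hx.trans_le ht).ne'
    refine (((hasDerivAt_neg t).exp.mul (hasDerivAt_log ht0)).neg).congr_deriv ?_
    ring
  have hlim : Tendsto (fun t : ℝ => -(exp (-t) * log t)) atTop (𝓝 0) := by
    have h1 : Tendsto (fun t : ℝ => t ^ 1 * exp (-t)) atTop (𝓝 0) :=
      tendsto_pow_mul_exp_neg_atTop_nhds_zero 1
    rw [← neg_zero]
    refine Tendsto.neg (squeeze_zero' ?_ ?_ h1)
    · filter_upwards [eventually_ge_atTop 1] with t ht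
      exact mul_nonneg (exp_pos _).le (log_nonneg ht)
    · filter_upwards [eventually_ge_atTop 1] with t ht
      rw [mul_comm, pow_one]
      gcongr
      exact log_le_self (by linarith)
  have h := integral_Ioi_of_hasDerivAt_of_tendsto' hderiv
    (hlog.sub (integrableOn_exp_neg_div hx)) hlim
  rw [integral_sub hlog (integrableOn_exp_neg_div hx)] at h
  rw [incGamma]
  linarith

lemma tendsto_incGamma_add_log :
    Tendsto (fun x => incGamma x + 1 * log x) (𝓝[>] 0) (𝓝 (-eulerMascheroniConstant)) := by
  have h1 : Tendsto (fun x => ∫ t in Set.Ioi x, log t * exp (-t)) (𝓝[>] 0)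
      (𝓝 (-eulerMascheroniConstant)) := by
    rw [← integral_log_mul_exp_neg]
    have hc : AECover (volume.restrict (Set.Ioi (0 : ℝ))) (𝓝[>] (0 : ℝ)) fun x => Set.Ioi x :=
      aecover_Ioi_of_Ioi nhdsWithin_le_nhds
    refine (hc.integral_tendsto_of_countably_generated integrableOn_log_mul_exp_neg).congr' ?_
    filter_upwards [self_mem_nhdsWithin] with x hx
    rw [Measure.restrict_restrict measurableSet_Ioi,
      Set.inter_eq_left.2 (Set.Ioi_subset_Ioi (le_of_lt hx))]
  have h2 : Tendsto (fun x : ℝ => (1 - exp (-x)) * log x) (𝓝[>] 0) (𝓝 0) := by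
    have h3 := tendsto_log_mul_rpow_nhdsGT_zero one_pos
    refine squeeze_zero_norm' ?_ (by simpa using h3.norm)
    filter_upwards [self_mem_nhdsWithin] with x hx
    have hx : 0 < x := hx
    rw [norm_mul, mul_comm, norm_eq_abs (log x), abs_of_pos hx]
    gcongr
    rw [norm_of_nonneg]
    · linarith [add_one_le_exp (-x)]
    · have : exp (-x) ≤ 1 := exp_le_one_iff.2 (by linarith)
      linarith
  have h := h1.add h2
  rw [add_zero] at h
  refine h.congr' ?_
  filter_upwards [self_mem_nhdsWithin] with x hx
  rw [incGamma_eq_integral_log hx]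
  ring

/-- The difference between `1 / u ^ 2` and `1 / (u * (exp u - 1))`. -/
noncomputable def boseKernel (u : ℝ) : ℝ := (1 / u - 1 / (exp u - 1)) * (1 / u)

lemma exp_sub_one_pos {u : ℝ} (hu : 0 < u) : 0 < exp u - 1 := by
  linarith [add_one_lt_exp hu.ne']

lemma inv_sub_inv_exp_nonneg {u : ℝ} (hu : 0 < u) : 0 ≤ 1 / u - 1 / (exp u - 1) := by
  have h := add_one_le_exp u
  rw [sub_nonneg]
  exact one_div_le_one_div_of_le hu (by linarith)

lemma sq_mul_exp_le {u : ℝ} (hu : 0 ≤ u) : u ^ 2 * exp u ≤ (exp u - 1) ^ 2 := by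
  have h1 : u / 2 ≤ sinh (u / 2) := self_le_sinh_iff.2 (by linarith)
  rw [sinh_eq] at h1
  have h2 : exp u = exp (u / 2) ^ 2 := by
    rw [← exp_nat_mul]
    congr 1
    push_cast
    ring
  have h3 : exp (-(u / 2)) * exp (u / 2) = 1 := by rw [← exp_add]; simp
  have h4 : u * exp (u / 2) ≤ exp u - 1 := by
    rw [h2]
    nlinarith [exp_pos (u / 2)]
  calc u ^ 2 * exp u = (u * exp (u / 2)) ^ 2 := by rw [h2]; ring
    _ ≤ (exp u - 1) ^ 2 := by gcongr

lemma antitoneOn_inv_sub_inv_exp :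
    AntitoneOn (fun u : ℝ => 1 / u - 1 / (exp u - 1)) (Set.Ioi 0) := by
  have hd : ∀ u ∈ Set.Ioi (0 : ℝ), HasDerivAt (fun u : ℝ => 1 / u - 1 / (exp u - 1))
      (-1 / u ^ 2 + exp u / (exp u - 1) ^ 2) u := by
    intro u hu
    have hu : 0 < u := hu
    have h := exp_sub_one_pos hu
    have h1 := (hasDerivAt_id u).inv hu.ne'
    have h2 := ((hasDerivAt_exp u).sub_const 1).inv h.ne'
    simp only [one_div]
    refine (h1.sub h2).congr_deriv ?_
    simp only [id]
    ring
  refine antitoneOn_of_deriv_nonpos (convex_Ioi 0)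
    (fun u hu => (hd u hu).continuousAt.continuousWithinAt) ?_ ?_
  · rw [interior_Ioi]
    exact fun u hu => (hd u hu).differentiableAt.differentiableWithinAt
  · rw [interior_Ioi]
    intro u hu
    rw [(hd u hu).deriv]
    have hu : 0 < u := hu
    have h := exp_sub_one_pos hu
    have : exp u / (exp u - 1) ^ 2 ≤ 1 / u ^ 2 := by
      rw [div_le_div_iff₀ (by positivity) (by positivity)]
      linarith [sq_mul_exp_le hu.le]
    rw [neg_div]
    linarith

lemma antitoneOn_boseKernel : AntitoneOn boseKernel (Set.Ioi 0) := by
  intro a ha b hb hab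
  exact mul_le_mul (antitoneOn_inv_sub_inv_exp ha hb hab) (one_div_le_one_div_of_le ha hab)
    (one_div_pos.2 hb).le (inv_sub_inv_exp_nonneg ha)

lemma measurable_boseKernel : Measurable boseKernel := by
  unfold boseKernel
  fun_prop

lemma hasIntegral_inv_sq {x : ℝ} (hx : 0 < x) :
    IntegrableOn (fun u : ℝ => 1 / u ^ 2) (Set.Ioi x) ∧ ∫ u in Set.Ioi x, 1 / u ^ 2 = 1 / x := by
  have he : Set.EqOn (fun u : ℝ => u ^ (-2 : ℝ)) (fun u : ℝ => 1 / u ^ 2) (Set.Ioi x) := by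
    intro u hu
    have hu : 0 < u := hx.trans hu
    simp only
    rw [rpow_neg hu.le, one_div]
    norm_num
  refine ⟨(integrableOn_Ioi_rpow_of_lt (by norm_num) hx).congr_fun he measurableSet_Ioi, ?_⟩
  rw [← setIntegral_congr_fun measurableSet_Ioi he, integral_Ioi_rpow_of_lt (by norm_num) hx]
  norm_num [rpow_neg hx.le]

lemma integrableOn_boseKernel (x : ℝ) (hx : 0 < x) : IntegrableOn boseKernel (Set.Ioi x) := by
  refine (hasIntegral_inv_sq hx).1.mono' measurable_boseKernel.aestronglyMeasurable ?_
  refine (ae_restrict_mem measurableSet_Ioi).mono fun u hu => ?_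
  have hu : 0 < u := hx.trans hu
  have h0 := inv_sub_inv_exp_nonneg hu
  have h1 : 0 < 1 / (exp u - 1) := one_div_pos.2 (exp_sub_one_pos hu)
  rw [boseKernel, norm_of_nonneg (by positivity), pow_two, ← one_div_mul_one_div]
  gcongr
  linarith

/-- The tail integral of `boseKernel`. -/
noncomputable def boseTail (x : ℝ) : ℝ := ∫ u in Set.Ioi x, boseKernel u

lemma incGamma_mul {x b : ℝ} (hb : 0 < b) :
    incGamma (x * b) = ∫ u in Set.Ioi x, exp (-(b * u)) / u := by
  rw [incGamma, mul_comm, ← integral_comp_mul_left_Ioi' _ x hb, smul_eq_mul,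
    ← integral_const_mul]
  congr 1
  ext u
  field_simp

lemma hasSum_exp_neg_mul_div {u : ℝ} (hu : 0 < u) :
    HasSum (fun m : ℕ => exp (-((m + 1 : ℝ) * u)) / u) (1 / u ^ 2 - boseKernel u) := by
  have h1 : exp (-u) < 1 := exp_lt_one_iff.2 (by linarith)
  have h2 := ((hasSum_geometric_of_lt_one (exp_pos (-u)).le h1).mul_left (exp (-u))).div_const u
  have e1 : 1 / u ^ 2 - boseKernel u = exp (-u) * (1 - exp (-u))⁻¹ / u := by
    have h3 := exp_sub_one_pos hu
    have h4 : exp u ≠ 0 := (exp_pos u).ne'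
    have h5 : 1 - (exp u)⁻¹ = (exp u - 1) / exp u := by field_simp
    rw [boseKernel, exp_neg, h5]
    field_simp
    ring
  have e2 : (fun m : ℕ => exp (-((m + 1 : ℝ) * u)) / u) =
      fun m : ℕ => exp (-u) * exp (-u) ^ m / u := by
    ext m
    rw [← exp_nat_mul, ← exp_add]
    ring_nf
  rw [e1, e2]
  exact h2

lemma hasSum_incGamma {x : ℝ} (hx : 0 < x) :
    HasSum (fun m : ℕ => incGamma (x * (m + 1))) (1 / x - boseTail x) := by
  have hpint : ∀ m : ℕ, IntegrableOn (fun u => exp (-((m + 1 : ℝ) * u)) / u) (Set.Ioi x) := by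
    intro m
    refine (integrableOn_exp_neg_div hx).mono' ?_ ?_
    · exact (Measurable.aestronglyMeasurable (by fun_prop))
    · refine (ae_restrict_mem measurableSet_Ioi).mono fun u hu => ?_
      have hu : 0 < u := hx.trans hu
      rw [norm_of_nonneg (by positivity)]
      gcongr
      nlinarith [(Nat.cast_nonneg m : (0 : ℝ) ≤ m)]
  have heq : ∀ m : ℕ, incGamma (x * (m + 1)) =
      ∫ u in Set.Ioi x, exp (-((m + 1 : ℝ) * u)) / u := fun m => incGamma_mul (by positivity)
  have hnorm : ∀ m : ℕ, ∫ u in Set.Ioi x, ‖exp (-((m + 1 : ℝ) * u)) / u‖ =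
      incGamma (x * (m + 1)) := by
    intro m
    rw [heq m]
    refine setIntegral_congr_fun measurableSet_Ioi fun u hu => ?_
    have hu : 0 < u := hx.trans hu
    exact norm_of_nonneg (by positivity)
  have hsum : Summable fun m : ℕ => incGamma (x * (m + 1)) := by
    have h1 : exp (-x) < 1 := exp_lt_one_iff.2 (by linarith)
    refine Summable.of_nonneg_of_le (fun m => incGamma_nonneg (by positivity)) (fun m => ?_)
      ((summable_geometric_of_lt_one (exp_pos (-x)).le h1).div_const x)
    refine (incGamma_le (by positivity)).trans ?_
    rw [← exp_nat_mul]
    have := (Nat.cast_nonneg m : (0 : ℝ) ≤ m)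
    gcongr
    · nlinarith
    · nlinarith
  have h := hasSum_integral_of_summable_integral_norm hpint
    (by simpa only [hnorm] using hsum)
  simp only [← heq] at h
  have hval : ∫ u in Set.Ioi x, ∑' m : ℕ, exp (-((m + 1 : ℝ) * u)) / u =
      ∫ u in Set.Ioi x, (1 / u ^ 2 - boseKernel u) :=
    setIntegral_congr_fun measurableSet_Ioi
      fun u hu => (hasSum_exp_neg_mul_div (hx.trans hu)).tsum_eq
  rw [hval, integral_sub (hasIntegral_inv_sq hx).1 (integrableOn_boseKernel x hx),
    (hasIntegral_inv_sq hx).2] at h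
  exact h

lemma abs_boseKernel_sub_le {u : ℝ} (hu : 0 < u) (hu1 : u ≤ 1) :
    |boseKernel u - 1 / 2 * u⁻¹| ≤ 1 := by
  have hb := exp_bound (abs_le.2 ⟨by linarith, hu1⟩) (n := 3) (by norm_num)
  simp only [Finset.sum_range_succ, Finset.sum_range_zero, abs_of_pos hu] at hb
  norm_num [Nat.factorial] at hb
  obtain ⟨hb1, hb2⟩ := abs_le.1 hb
  have h3 := exp_sub_one_pos hu
  have hq : u + u ^ 2 / 2 ≤ exp u - 1 := by linarith [quadratic_le_exp_of_nonneg hu.le]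
  have he : boseKernel u - 1 / 2 * u⁻¹ =
      (2 * (exp u - 1 - u) - u * (exp u - 1)) / (2 * u ^ 2 * (exp u - 1)) := by
    rw [boseKernel]
    field_simp
  have hu3 : 0 < u ^ 3 := by positivity
  have hd : 2 * u ^ 3 ≤ 2 * u ^ 2 * (exp u - 1) := by nlinarith [pow_pos hu 2]
  rw [he, abs_div, abs_of_pos (show 0 < 2 * u ^ 2 * (exp u - 1) by positivity),
    div_le_one (by positivity)]
  refine le_trans ?_ hd
  rw [abs_le]
  constructor <;> nlinarith

lemma exists_tendsto_boseTail_add_log :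
    ∃ β, Tendsto (fun x => boseTail x + 1 / 2 * log x) (𝓝[>] 0) (𝓝 β) := by
  have hr : IntegrableOn (fun u => boseKernel u - 1 / 2 * u⁻¹) (Set.uIcc 0 1) := by
    rw [Set.uIcc_of_le zero_le_one, integrableOn_Icc_iff_integrableOn_Ioc]
    refine IntegrableOn.of_bound (by simp) ?_ 1 ?_
    · exact (measurable_boseKernel.sub (by fun_prop)).aestronglyMeasurable
    · exact (ae_restrict_mem measurableSet_Ioc).mono fun u hu => abs_boseKernel_sub_le hu.1 hu.2
  have hc := intervalIntegral.continuousOn_primitive_interval_left hr 0 (by simp)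
  rw [Set.uIcc_of_le zero_le_one] at hc
  have hle : 𝓝[>] (0 : ℝ) ≤ 𝓝[Set.Icc 0 1] 0 := by
    rw [← nhdsWithin_Ioc_eq_nhdsGT (zero_lt_one' ℝ)]
    exact nhdsWithin_mono _ Set.Ioc_subset_Icc_self
  have h := (hc.tendsto.mono_left hle).const_add (boseTail 1)
  refine ⟨_, h.congr' ?_⟩
  filter_upwards [Ioc_mem_nhdsGT (zero_lt_one' ℝ)] with x hx
  have h0 : (0 : ℝ) ∉ Set.uIcc x 1 := Set.notMem_uIcc_of_lt hx.1 one_pos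
  rw [intervalIntegral.integral_sub, intervalIntegral.integral_const_mul, integral_inv h0,
    ← intervalIntegral.integral_Ioi_sub_Ioi (integrableOn_boseKernel x hx.1) hx.2]
  · simp only [boseTail, one_div, log_inv]
    ring
  · rw [intervalIntegrable_iff_integrableOn_Ioc_of_le hx.2]
    exact (integrableOn_boseKernel x hx.1).mono_set Set.Ioc_subset_Ioi_self
  · exact (intervalIntegral.intervalIntegrable_inv (fun u hu => by
      rintro rfl; exact h0 hu) continuousOn_id).const_mul _

lemma tsum_alternating_incGamma {ε : ℝ} (hε : 0 < ε) :
    ∑' n : ℕ, (incGamma (ε * (2 * n + 1)) - incGamma (ε * (2 * n + 2))) =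
      2 * boseTail (2 * ε) - boseTail ε := by
  have h1 := hasSum_incGamma hε
  have h2 := hasSum_incGamma (show 0 < 2 * ε by positivity)
  have hodd : HasSum (fun n : ℕ => incGamma (ε * (2 * n + 2))) (1 / (2 * ε) - boseTail (2 * ε)) := by
    have e : (fun n : ℕ => incGamma (ε * (2 * n + 2))) =
        fun n : ℕ => incGamma (2 * ε * (n + 1)) := by
      ext n
      rw [show ε * (2 * (n : ℝ) + 2) = 2 * ε * (n + 1) by ring]
    rw [e]
    exact h2
  set f : ℕ → ℝ := fun m => incGamma (ε * (m + 1)) with hf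
  have feven : ∀ n : ℕ, f (2 * n) = incGamma (ε * (2 * n + 1)) := fun n => by
    simp only [hf]
    push_cast
    rfl
  have fodd : ∀ n : ℕ, f (2 * n + 1) = incGamma (ε * (2 * n + 2)) := fun n => by
    simp only [hf]
    push_cast
    rw [show 2 * (n : ℝ) + 1 + 1 = 2 * n + 2 by ring]
  have heven : Summable fun n : ℕ => incGamma (ε * (2 * n + 1)) := by
    have := h1.summable.comp_injective (mul_right_injective₀ (two_ne_zero' ℕ))
    simpa only [Function.comp_def, feven] using this
  have hs := tsum_even_add_odd (f := f) (by simpa only [feven] using heven)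
    (by simpa only [fodd] using hodd.summable)
  simp only [feven, fodd] at hs
  rw [hodd.tsum_eq, h1.tsum_eq] at hs
  rw [heven.tsum_sub hodd.summable, hodd.tsum_eq]
  have : 1 / ε = 2 * (1 / (2 * ε)) := by field_simp
  linarith

lemma tendsto_boseTail_add_log :
    Tendsto (fun x => boseTail x + 1 / 2 * log x) (𝓝[>] 0)
      (𝓝 (1 / 2 * log (2 * π) - eulerMascheroniConstant / 2)) := by
  obtain ⟨β, hβ⟩ := exists_tendsto_boseTail_add_log
  have h1 := tendsto_tsum_sub_add_log (k := 2) two_pos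
    (tendsto_tailIntegral fun x hx => integrableOn_exp_neg_div hx)
    (tailIntegral_sub_le (fun x hx => integrableOn_exp_neg_div hx) antitoneOn_exp_neg_div)
    tendsto_incGamma_add_log
  have h2 : Tendsto (fun ε : ℝ => 2 * ε) (𝓝[>] 0) (𝓝[>] 0) := by
    refine tendsto_nhdsWithin_of_tendsto_nhds_of_eventually_within _ ?_ ?_
    · have : Tendsto (fun ε : ℝ => 2 * ε) (𝓝 0) (𝓝 (2 * 0)) := by
        exact (continuous_const.mul continuous_id).tendsto 0
      simpa using this.mono_left nhdsWithin_le_nhds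
    · filter_upwards [self_mem_nhdsWithin] with x hx
      exact mul_pos two_pos (Set.mem_Ioi.1 hx)
  have h3 := (((hβ.comp h2).const_mul 2).sub hβ).sub_const (log 2)
  have h4 : Tendsto (fun ε : ℝ => (∑' n : ℕ, (incGamma (ε * ((2 : ℕ) * n + 1)) -
      incGamma (ε * ((2 : ℕ) * n + 2)))) + 1 / (2 : ℕ) * log ε) (𝓝[>] 0)
      (𝓝 (2 * β - β - log 2)) := by
    refine h3.congr' ?_
    filter_upwards [self_mem_nhdsWithin] with x hx
    have hx : 0 < x := hx
    push_cast
    rw [tsum_alternating_incGamma hx, Function.comp, log_mul two_ne_zero hx.ne']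
    ring
  have h5 := tendsto_nhds_unique h4 h1
  have h6 : log (Gamma (1 / 2)) = 1 / 2 * log π := by
    rw [Gamma_one_half_eq, sqrt_eq_rpow, log_rpow pi_pos]
  push_cast at h5
  rw [h6, div_self two_ne_zero, Gamma_one, log_one] at h5
  convert hβ using 2
  rw [log_mul two_ne_zero pi_ne_zero]
  linarith

lemma hasSum_inv_three_mul_add_four_sub :
    HasSum (fun n : ℕ => (1 / (3 * n + 4) - 1 / (3 * n + 2) : ℝ)) (π / (3 * √3) - 1) := by
  have hx : ((1 / 3 : ℝ) : ℂ) ∈ Complex.integerComplement := by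
    rintro ⟨n, hn⟩
    have h : ((n : ℝ) : ℂ) = ((1 / 3 : ℝ) : ℂ) := by rw [← hn]; simp
    have h2 : (n : ℝ) = 1 / 3 := Complex.ofReal_injective h
    have h3 : (3 * n : ℝ) = 1 := by rw [h2]; norm_num
    have h4 : 3 * n = 1 := by exact_mod_cast h3
    omega
  have hs := (summable_cotTerm hx).hasSum
  rw [← cot_series_rep' hx] at hs
  have hcot : (π : ℂ) * Complex.cot (π * ((1 / 3 : ℝ) : ℂ)) - 1 / ((1 / 3 : ℝ) : ℂ) =
      ((π / √3 - 3 : ℝ) : ℂ) := by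
    rw [← Complex.ofReal_mul, ← Complex.ofReal_cot, cot_eq_cos_div_sin,
      show π * (1 / 3) = π / 3 by ring, cos_pi_div_three, sin_pi_div_three]
    push_cast
    field_simp
  have hterm : (fun n : ℕ => cotTerm ((1 / 3 : ℝ) : ℂ) n) =
      fun n : ℕ => ((3 * (1 / (3 * n + 4) - 1 / (3 * n + 2)) : ℝ) : ℂ) := by
    ext n
    have h1 : (1 / 3 - ((n : ℝ) + 1)) ≠ 0 := by
      have := (Nat.cast_nonneg n : (0 : ℝ) ≤ n)
      linarith
    have h : (3 * (1 / (3 * n + 4) - 1 / (3 * n + 2)) : ℝ) =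
        1 / (1 / 3 - (n + 1)) + 1 / (1 / 3 + (n + 1)) := by
      rw [show (1 / 3 - ((n : ℝ) + 1)) = -((3 * n + 2) / 3) by ring,
        show (1 / 3 + ((n : ℝ) + 1)) = (3 * n + 4) / 3 by ring]
      field_simp
      ring
    rw [h]
    push_cast
    rfl
  rw [hcot, hterm, Complex.hasSum_ofReal] at hs
  have h := hs.mul_left (1 / 3)
  have he : 1 / 3 * (π / √3 - 3) = π / (3 * √3) - 1 := by
    field_simp
  rw [he] at h
  simpa [← mul_assoc] using h

lemma hasSum_inv_three_mul_add_one_sub :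
    HasSum (fun n : ℕ => (1 / (3 * n + 1) - 1 / (3 * n + 2) : ℝ)) (π / (3 * √3)) := by
  rw [hasSum_iff_tendsto_nat_of_nonneg]
  · have h1 := hasSum_inv_three_mul_add_four_sub.tendsto_sum_nat
    have h2 : Tendsto (fun N : ℕ => (1 / (3 * N + 1) : ℝ)) atTop (𝓝 0) := by
      refine tendsto_const_nhds.div_atTop ?_
      exact (tendsto_natCast_atTop_atTop.const_mul_atTop (by norm_num)).atTop_add
        tendsto_const_nhds
    have h3 := (h1.add_const 1).sub h2
    rw [sub_add_cancel, sub_zero] at h3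
    refine h3.congr fun N => ?_
    induction N with
    | zero => simp
    | succ N ih =>
      rw [Finset.sum_range_succ, Finset.sum_range_succ, ← ih]
      push_cast
      rw [show 3 * ((N : ℝ) + 1) + 1 = 3 * N + 4 by ring]
      ring
  · intro n
    rw [sub_nonneg]
    gcongr
    norm_num

lemma summable_incGamma_mul {ε : ℝ} (hε : 0 < ε) :
    Summable fun c : ℕ+ × ℕ+ => incGamma (ε * ((c.1 * c.2 : ℕ) : ℝ)) := by
  have hr : ‖exp (-ε)‖ < 1 := by
    rw [norm_of_nonneg (exp_pos _).le]
    exact exp_lt_one_iff.2 (by linarith)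
  refine Summable.of_nonneg_of_le (fun c => incGamma_nonneg (by positivity)) (fun c => ?_)
    ((summable_prod_mul_pow 0 hr).div_const ε)
  have h1 : (1 : ℝ) ≤ ((c.1 * c.2 : ℕ) : ℝ) := by
    exact_mod_cast Nat.one_le_iff_ne_zero.2 (mul_ne_zero c.1.ne_zero c.2.ne_zero)
  refine (incGamma_le (by positivity)).trans ?_
  rw [pow_zero, one_mul, ← exp_nat_mul]
  have : -(ε * ((c.1 * c.2 : ℕ) : ℝ)) = ((c.1 * c.2 : ℕ) : ℝ) * -ε := by ring
  rw [this]
  gcongr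
  nlinarith

lemma tsum_pnat_incGamma {x : ℝ} (hx : 0 < x) :
    ∑' m : ℕ+, incGamma (x * m) = 1 / x - boseTail x := by
  rw [tsum_pnat_eq_tsum_succ (f := fun m : ℕ => incGamma (x * m)), ← (hasSum_incGamma hx).tsum_eq]
  push_cast
  rfl

lemma boseTail_sub_le (x y ε : ℝ) (hx : 0 < x) (hxy : x ≤ y) (hε : 0 ≤ ε) :
    boseTail y - boseTail (y + ε) ≤ boseTail x - boseTail (x + ε) :=
  tailIntegral_sub_le integrableOn_boseKernel antitoneOn_boseKernel x y ε hx hxy hε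

lemma summable_boseTail_sub {ε : ℝ} (hε : 0 < ε) :
    Summable fun n : ℕ => boseTail (ε * (3 * n + 1)) - boseTail (ε * (3 * n + 2)) := by
  have h := summable_sub_of_convex (u := fun i : ℕ => boseTail (ε * (i + 1))) (k := 3) ?_ ?_
    three_pos
  · refine h.congr fun n => ?_
    push_cast
    rw [show 3 * (n : ℝ) + 1 + 1 = 3 * n + 2 by ring]
  · intro i j hij
    have := boseTail_sub_le (ε * (i + 1)) (ε * (j + 1)) ε (by positivity) (by gcongr) hε.le
    simpa [mul_add, add_assoc] using this
  · exact (tendsto_tailIntegral integrableOn_boseKernel).comp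
      ((tendsto_natCast_atTop_atTop.atTop_add tendsto_const_nhds).const_mul_atTop hε)

lemma tsum_hex_incGamma {ε : ℝ} (hε : 0 < ε) :
    (∑' p : { p : ℤ × ℤ // p ≠ 0 },
        incGamma (ε * ((p.1.1 : ℝ) ^ 2 + (p.1.1 : ℝ) * (p.1.2 : ℝ) + (p.1.2 : ℝ) ^ 2))) =
      2 * π / √3 * (1 / ε) -
        6 * ∑' n : ℕ, (boseTail (ε * (3 * n + 1)) - boseTail (ε * (3 * n + 2))) := by
  have h := tsum_hex_eq (F := fun n : ℕ => incGamma (ε * n))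
    (fun n => incGamma_nonneg (by positivity)) (summable_incGamma_mul hε)
  have h1 : (∑' p : { p : ℤ × ℤ // p ≠ 0 },
        incGamma (ε * ((p.1.1 : ℝ) ^ 2 + (p.1.1 : ℝ) * (p.1.2 : ℝ) + (p.1.2 : ℝ) ^ 2))) =
      ∑' p : { p : ℤ × ℤ // p ≠ 0 },
        incGamma (ε * ((p.1.1 ^ 2 + p.1.1 * p.1.2 + p.1.2 ^ 2).toNat : ℝ)) := by
    refine tsum_congr fun p => ?_
    have h2 : (((p.1.1 ^ 2 + p.1.1 * p.1.2 + p.1.2 ^ 2).toNat : ℤ) : ℝ) =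
        ((p.1.1 ^ 2 + p.1.1 * p.1.2 + p.1.2 ^ 2 : ℤ) : ℝ) := by
      rw [Int.toNat_of_nonneg (hexForm_pos p.2).le]
    rw [Int.cast_natCast] at h2
    rw [h2]
    push_cast
    rfl
  rw [h1, h]
  have h3 : ∀ n : ℕ, (∑' m : ℕ+, incGamma (ε * (((3 * n + 1) * m : ℕ) : ℝ)) -
      ∑' m : ℕ+, incGamma (ε * (((3 * n + 2) * m : ℕ) : ℝ))) =
      1 / ε * (1 / (3 * n + 1) - 1 / (3 * n + 2)) -
        (boseTail (ε * (3 * n + 1)) - boseTail (ε * (3 * n + 2))) := by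
    intro n
    push_cast
    simp only [← mul_assoc]
    rw [tsum_pnat_incGamma (by positivity), tsum_pnat_incGamma (by positivity),
      ← one_div_mul_one_div, ← one_div_mul_one_div]
    ring
  rw [tsum_congr h3, Summable.tsum_sub (hasSum_inv_three_mul_add_one_sub.summable.mul_left _)
    (summable_boseTail_sub hε), tsum_mul_left, hasSum_inv_three_mul_add_one_sub.tsum_eq]
  field_simp
  ring

lemma log_Gamma_two_thirds :
    log (Gamma (2 / 3)) = log 2 + log π - 1 / 2 * log 3 - log (Gamma (1 / 3)) := by
  have h := Gamma_mul_Gamma_one_sub (1 / 3)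
  rw [show π * (1 / 3) = π / 3 by ring, sin_pi_div_three,
    show (1 - 1 / 3 : ℝ) = 2 / 3 by norm_num] at h
  have h1 : Gamma (1 / 3) ≠ 0 := (Gamma_pos_of_pos (by norm_num)).ne'
  have h2 : Gamma (2 / 3) ≠ 0 := (Gamma_pos_of_pos (by norm_num)).ne'
  have h3 : √3 ≠ 0 := by positivity
  have h4 := congrArg log h
  rw [log_mul h1 h2, log_div pi_ne_zero (by positivity), log_div h3 two_ne_zero,
    log_sqrt (by norm_num)] at h4
  linarith

lemma hexagonal_constant_eq :
    eulerMascheroniConstant + log (4 * π ^ 2 / (√3 * Gamma (1 / 3) ^ 6)) =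
      -6 * ((1 / 2 * log (2 * π) - eulerMascheroniConstant / 2) / (3 : ℕ) +
        1 / 2 * (log (Gamma (1 / (3 : ℕ))) - log (Gamma (2 / (3 : ℕ))) -
          log (3 : ℕ) / (3 : ℕ))) := by
  have h1 : Gamma (1 / 3) ≠ 0 := (Gamma_pos_of_pos (by norm_num)).ne'
  have h3 : √3 ≠ 0 := by positivity
  have hpi := pi_ne_zero
  push_cast
  rw [log_Gamma_two_thirds, log_div (by positivity) (by positivity), log_mul four_ne_zero
    (by positivity), log_mul h3 (by positivity), log_pow, log_pow, log_sqrt (by norm_num),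
    log_mul two_ne_zero hpi, show (4 : ℝ) = 2 ^ 2 by norm_num, log_pow]
  push_cast
  ring

theorem hexagonal_incGamma_expansion :
    Tendsto
      (fun ε : ℝ =>
        (∑' p : { p : ℤ × ℤ // p ≠ 0 },
            incGamma (ε * ((p.1.1 : ℝ) ^ 2 + (p.1.1 : ℝ) * (p.1.2 : ℝ) + (p.1.2 : ℝ) ^ 2)))
          - ((2 * π / Real.sqrt 3) * (1 / ε) - Real.log (1 / ε)))
      (nhdsWithin 0 (Set.Ioi 0))
      (nhds (Real.eulerMascheroniConstant
        + Real.log (4 * π ^ 2 / (Real.sqrt 3 * Real.Gamma (1 / 3) ^ 6)))) := by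
  have h := (tendsto_tsum_sub_add_log (H := boseTail) (k := 3) three_pos
    (tendsto_tailIntegral integrableOn_boseKernel) boseTail_sub_le
    tendsto_boseTail_add_log).const_mul (-6)
  rw [hexagonal_constant_eq]
  refine h.congr' ?_
  filter_upwards [self_mem_nhdsWithin] with ε hε
  have hε : 0 < ε := hε
  rw [tsum_hex_incGamma hε, one_div ε, log_inv]
  push_cast
  ring
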